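/- arXiv:1909.13152 — 2 statements merged into one kernel-verified Lean document; each statement's English description precedes it below -/
import Mathlib

section
/- Let ρ be a pure tripartite qudit state on ℂ^d ⊗ ℂ^d ⊗ ℂ^d. Then the sum of the three isotropic strengths satisfies s_iso^{AB} + s_iso^{BC} + s_iso^{AC} = (3d − 3 + (d−2)(‖a‖² + ‖b‖² + ‖c‖²))/(d²−1). -/
open Matrix ComplexOrder

namespace SpinCorr3

variable {d : ℕ}

/-- Tensor (Kronecker) product of three `d × d` matrices, acting on `ℂ^d ⊗ ℂ^d ⊗ ℂ^d`. -/
noncomputable def kron3 (A B C : Matrix (Fin d) (Fin d) ℂ) :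
    Matrix (Fin d × Fin d × Fin d) (Fin d × Fin d × Fin d) ℂ :=
  Matrix.of fun p q => A p.1 q.1 * B p.2.1 q.2.1 * C p.2.2 q.2.2

variable (lam : Fin (d ^ 2 - 1) → Matrix (Fin d) (Fin d) ℂ)
variable (ρ : Matrix (Fin d × Fin d × Fin d) (Fin d × Fin d × Fin d) ℂ)

/-- `‖a‖²`, the squared Euclidean norm of the Bloch vector of party A. -/
noncomputable def aSq : ℝ := ∑ i, ‖(ρ * kron3 (lam i) 1 1).trace‖ ^ 2

/-- `‖b‖²`. -/
noncomputable def bSq : ℝ := ∑ j, ‖(ρ * kron3 1 (lam j) 1).trace‖ ^ 2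

/-- `‖c‖²`. -/
noncomputable def cSq : ℝ := ∑ l, ‖(ρ * kron3 1 1 (lam l)).trace‖ ^ 2

/-- `‖R^{AB}‖²`, squared Frobenius norm of the spin correlation matrix of parties A,B. -/
noncomputable def RABsq : ℝ := ∑ i, ∑ j, ‖(ρ * kron3 (lam i) (lam j) 1).trace‖ ^ 2

/-- `‖R^{BC}‖²`. -/
noncomputable def RBCsq : ℝ := ∑ j, ∑ l, ‖(ρ * kron3 1 (lam j) (lam l)).trace‖ ^ 2

/-- `‖R^{AC}‖²`. -/
noncomputable def RACsq : ℝ := ∑ i, ∑ l, ‖(ρ * kron3 (lam i) 1 (lam l)).trace‖ ^ 2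

/-- `‖R^{ABC}‖²`, squared Euclidean norm of the tripartite correlation tensor. -/
noncomputable def RABCsq : ℝ := ∑ i, ∑ j, ∑ l, ‖(ρ * kron3 (lam i) (lam j) (lam l)).trace‖ ^ 2

/-- Isotropic strength `s_iso^{AB} = ‖R^{AB}‖²/(d²-1)`. -/
noncomputable def sAB : ℝ := RABsq lam ρ / ((d : ℝ) ^ 2 - 1)

/-- `s_iso^{BC}`. -/
noncomputable def sBC : ℝ := RBCsq lam ρ / ((d : ℝ) ^ 2 - 1)

/-- `s_iso^{AC}`. -/
noncomputable def sAC : ℝ := RACsq lam ρ / ((d : ℝ) ^ 2 - 1)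

/-- The partial trace over the second factor. -/
noncomputable def traceRight {m n : Type*} [Fintype n] (σ : Matrix (m × n) (m × n) ℂ) :
    Matrix m m ℂ :=
  Matrix.of fun a a' => ∑ b, σ (a, b) (a', b)

/-- The partial trace over the first factor. -/
noncomputable def traceLeft {m n : Type*} [Fintype m] (σ : Matrix (m × n) (m × n) ℂ) :
    Matrix n n ℂ :=
  Matrix.of fun b b' => ∑ a, σ (a, b) (a, b')

/-- The completeness relation `∑ k, F k ⊗ F k = c • SWAP` of a family of matrices. -/
def IsComplete {ι m : Type*} [Fintype ι] [DecidableEq m] (F : ι → Matrix m m ℂ) (c : ℂ) : Prop :=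
  ∀ p q r s, ∑ k, F k p q * F k r s = if p = s ∧ q = r then c else 0

theorem IsComplete.kronecker {ι κ m n : Type*} [Fintype ι] [Fintype κ] [DecidableEq m]
    [DecidableEq n] {F : ι → Matrix m m ℂ} {G : κ → Matrix n n ℂ} {c e : ℂ}
    (hF : IsComplete F c) (hG : IsComplete G e) :
    IsComplete (fun k : ι × κ => Matrix.kronecker (F k.1) (G k.2)) (c * e) := by
  rintro ⟨p, p'⟩ ⟨q, q'⟩ ⟨r, r'⟩ ⟨s, s'⟩
  have h : ∀ k : ι × κ, Matrix.kronecker (F k.1) (G k.2) (p, p') (q, q') *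
      Matrix.kronecker (F k.1) (G k.2) (r, r') (s, s') =
      (F k.1 p q * F k.1 r s) * (G k.2 p' q' * G k.2 r' s') := by
    intro k
    simp only [Matrix.kronecker, Matrix.kroneckerMap_apply]
    ring
  simp only [h, Fintype.sum_prod_type, ← Finset.mul_sum, ← Finset.sum_mul, hF _ _ _ _, hG _ _ _ _,
    Prod.mk.injEq]
  split_ifs <;> simp_all

section Bipartite

variable {ι κ m n : Type*} [Fintype ι] [Fintype κ] [Fintype m] [Fintype n]

theorem trace_mul_kronecker_one [DecidableEq n] (σ : Matrix (m × n) (m × n) ℂ) (X : Matrix m m ℂ) :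
    (σ * Matrix.kronecker X (1 : Matrix n n ℂ)).trace = (traceRight σ * X).trace := by
  simp only [Matrix.trace, Matrix.diag, Matrix.mul_apply, Fintype.sum_prod_type, traceRight,
    Matrix.kronecker, Matrix.kroneckerMap_apply, Matrix.of_apply, Matrix.one_apply, mul_ite,
    mul_one, mul_zero, Finset.sum_ite_eq', Finset.mem_univ, if_true, Finset.sum_mul]
  exact Finset.sum_congr rfl fun _ _ => Finset.sum_comm

theorem trace_mul_one_kronecker [DecidableEq m] (σ : Matrix (m × n) (m × n) ℂ) (X : Matrix n n ℂ) :
    (σ * Matrix.kronecker (1 : Matrix m m ℂ) X).trace = (traceLeft σ * X).trace := by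
  simp only [Matrix.trace, Matrix.diag, Matrix.mul_apply, Fintype.sum_prod_type, traceLeft,
    Matrix.kronecker, Matrix.kroneckerMap_apply, Matrix.of_apply, Matrix.one_apply, ite_mul,
    one_mul, zero_mul, mul_ite, mul_zero, Finset.sum_mul]
  simp only [Finset.sum_ite_irrel, Finset.sum_const_zero, Finset.sum_ite_eq',
    Finset.mem_univ, if_true]
  rw [Finset.sum_comm]
  exact Finset.sum_congr rfl fun _ _ => Finset.sum_comm

theorem IsComplete.sum_trace_mul_sq [DecidableEq m] {F : ι → Matrix m m ℂ} {c : ℂ}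
    (hF : IsComplete F c) (P : Matrix m m ℂ) : ∑ k, (P * F k).trace ^ 2 = c * (P * P).trace := by
  have h : ∀ k, (P * F k).trace ^ 2 =
      ∑ a, ∑ b, ∑ a', ∑ b', P a b * P a' b' * (F k b a * F k b' a') := by
    intro k
    simp only [Matrix.trace, Matrix.diag, Matrix.mul_apply, sq, Finset.sum_mul, Finset.mul_sum]
    refine Finset.sum_congr rfl fun _ _ => Finset.sum_congr rfl fun _ _ =>
      Finset.sum_congr rfl fun _ _ => Finset.sum_congr rfl fun _ _ => by ring
  simp only [h]
  rw [Finset.sum_comm]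
  simp only [Finset.sum_comm (s := (Finset.univ : Finset ι)), ← Finset.mul_sum, hF _ _ _ _]
  simp only [Matrix.trace, Matrix.diag, Matrix.mul_apply, Finset.mul_sum]
  refine Finset.sum_congr rfl fun a _ => Finset.sum_congr rfl fun b _ => ?_
  simp [ite_and, mul_comm]

theorem trace_traceRight_sq {σ : Matrix (m × n) (m × n) ℂ}
    (hσ : ∀ p q r s, σ p q * σ r s = σ p s * σ r q) :
    (traceRight σ * traceRight σ).trace = (traceLeft σ * traceLeft σ).trace := by
  simp only [Matrix.trace, Matrix.diag, Matrix.mul_apply, traceRight, traceLeft, Matrix.of_apply,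
    Finset.sum_mul_sum]
  calc
    _ = ∑ a, ∑ a', ∑ b, ∑ b', σ (a, b) (a, b') * σ (a', b') (a', b) := by
      refine Finset.sum_congr rfl fun a _ => Finset.sum_congr rfl fun a' _ =>
        Finset.sum_congr rfl fun b _ => Finset.sum_congr rfl fun b' _ => hσ _ _ _ _
    _ = ∑ a, ∑ b, ∑ a', ∑ b', σ (a, b) (a, b') * σ (a', b') (a', b) :=
      Finset.sum_congr rfl fun _ _ => Finset.sum_comm
    _ = ∑ b, ∑ a, ∑ a', ∑ b', σ (a, b) (a, b') * σ (a', b') (a', b) := Finset.sum_comm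
    _ = ∑ b, ∑ a, ∑ b', ∑ a', σ (a, b) (a, b') * σ (a', b') (a', b) :=
      Finset.sum_congr rfl fun _ _ => Finset.sum_congr rfl fun _ _ => Finset.sum_comm
    _ = _ := Finset.sum_congr rfl fun _ _ => Finset.sum_comm

theorem IsComplete.mul_sum_trace_kronecker_sq [DecidableEq m] [DecidableEq n]
    {F : ι → Matrix m m ℂ} {G : κ → Matrix n n ℂ}
    {c e : ℂ} (hF : IsComplete F c) (hG : IsComplete G e) {T : Type*} [Fintype T]
    {ρ : Matrix T T ℂ} (hρ : ∀ p q r s, ρ p q * ρ r s = ρ p s * ρ r q) (φ : T ≃ m × n) :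
    e * ∑ k, (ρ * (Matrix.kronecker (F k) (1 : Matrix n n ℂ)).submatrix φ φ).trace ^ 2 =
      c * ∑ l, (ρ * (Matrix.kronecker (1 : Matrix m m ℂ) (G l)).submatrix φ φ).trace ^ 2 := by
  have h : ∀ X : Matrix (m × n) (m × n) ℂ, (ρ * X.submatrix φ φ).trace =
      (ρ.submatrix φ.symm φ.symm * X).trace := by
    intro X
    simp only [Matrix.trace, Matrix.diag, Matrix.mul_apply, Matrix.submatrix_apply]
    refine Fintype.sum_equiv φ _ _ fun x => Fintype.sum_equiv φ _ _ fun y => by simp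
  simp only [h, trace_mul_kronecker_one, trace_mul_one_kronecker, hF.sum_trace_mul_sq,
    hG.sum_trace_mul_sq]
  rw [trace_traceRight_sq (σ := ρ.submatrix φ.symm φ.symm) fun _ _ _ _ => hρ _ _ _ _]
  ring

end Bipartite

/-- An idempotent matrix of trace one has vanishing two-by-two minors. -/
theorem mul_eq_mul_of_idempotent_of_trace_eq_one {T : Type*} [Fintype T] [DecidableEq T]
    {ρ : Matrix T T ℂ} (hpure : ρ * ρ = ρ) (htr : ρ.trace = 1) (p q r s : T) :
    ρ p q * ρ r s = ρ p s * ρ r q := by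
  have hid : IsIdempotentElem (Matrix.toLin' ρ) := by
    rw [IsIdempotentElem, Module.End.mul_eq_comp, ← Matrix.toLin'_mul, hpure]
  have hrank : Module.finrank ℂ (LinearMap.range (Matrix.toLin' ρ)) = 1 := by
    have := (LinearMap.IsIdempotentElem.isProj_range _ hid).trace
    rw [Matrix.trace_toLin'_eq, htr] at this
    exact_mod_cast this.symm
  obtain ⟨v, -, hv⟩ := finrank_eq_one_iff'.mp hrank
  have hcol : ∀ q, ∃ c : ℂ, ∀ p, ρ p q = c * (v : T → ℂ) p := by
    intro q
    obtain ⟨c, hc⟩ := hv ⟨_, LinearMap.mem_range_self _ (Pi.single q 1)⟩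
    refine ⟨c, fun p => ?_⟩
    have := congrFun (congrArg Subtype.val hc) p
    simpa using this.symm
  choose c hc using hcol
  simp only [hc]
  ring

/-- The identity together with a basis of the traceless matrices. -/
noncomputable def withOne {ι : Type*} (lam : ι → Matrix (Fin d) (Fin d) ℂ) :
    Option ι → Matrix (Fin d) (Fin d) ℂ
  | none => 1
  | some i => lam i

theorem isComplete_withOne (hd : 2 ≤ d) {lam : Fin (d ^ 2 - 1) → Matrix (Fin d) (Fin d) ℂ}
    (htr0 : ∀ i, (lam i).trace = 0)
    (horth : ∀ i j, (lam i * lam j).trace = if i = j then (d : ℂ) else 0) :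
    IsComplete (withOne lam) (d : ℂ) := by
  have hd0 : (d : ℂ) ≠ 0 := by norm_cast; lia
  have horth' : ∀ k l, (withOne lam k * withOne lam l).trace = if k = l then (d : ℂ) else 0 := by
    rintro (_ | i) (_ | j) <;> simp [withOne, htr0, horth]
  have hcard : Fintype.card (Option (Fin (d ^ 2 - 1))) = Fintype.card (Fin d × Fin d) := by
    have : 1 ≤ d ^ 2 := Nat.one_le_pow _ _ (by lia)
    simp only [Fintype.card_option, Fintype.card_fin, Fintype.card_prod]
    rw [← sq]
    lia
  let M : Matrix (Option (Fin (d ^ 2 - 1))) (Fin d × Fin d) ℂ :=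
    Matrix.of fun k p => (d : ℂ)⁻¹ * withOne lam k p.1 p.2
  let N : Matrix (Fin d × Fin d) (Option (Fin (d ^ 2 - 1))) ℂ :=
    Matrix.of fun p k => withOne lam k p.2 p.1
  have hMN : M * N = 1 := by
    ext k l
    have h := horth' k l
    simp only [Matrix.trace, Matrix.diag, Matrix.mul_apply] at h
    simp only [M, N, Matrix.mul_apply, Matrix.of_apply, Fintype.sum_prod_type, mul_assoc,
      ← Finset.mul_sum, h, Matrix.one_apply]
    split_ifs <;> simp [hd0]
  have hNM : N * M = 1 := (Matrix.mul_eq_one_comm_of_card_eq _ _ _ hcard).mp hMN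
  intro p q r s
  have h := congrFun (congrFun hNM (q, p)) (r, s)
  simp only [M, N, Matrix.mul_apply, Matrix.of_apply, Matrix.one_apply, Prod.mk.injEq,
    mul_left_comm _ (d : ℂ)⁻¹, ← Finset.mul_sum] at h
  rw [inv_mul_eq_iff_eq_mul₀ hd0] at h
  rw [h]
  simp [and_comm]

theorem norm_trace_mul_sq {T : Type*} [Fintype T] {A B : Matrix T T ℂ} (hA : A.IsHermitian)
    (hB : B.IsHermitian) : ((‖(A * B).trace‖ ^ 2 : ℝ) : ℂ) = (A * B).trace ^ 2 := by
  have h : star (A * B).trace = (A * B).trace := by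
    rw [← Matrix.trace_conjTranspose, Matrix.conjTranspose_mul, hA.eq, hB.eq, Matrix.trace_mul_comm]
  have h2 := RCLike.mul_conj (A * B).trace
  rw [starRingEnd_apply, h] at h2
  rw [sq (Matrix.trace _), h2]
  norm_cast

/-- Expansion of the equality of the purities of the marginals on the first two parties and on the
third one, for a pure state on a space identified with `ℂ^d ⊗ ℂ^d ⊗ ℂ^d` along `φ`. -/
theorem bloch_norm_relation (hd : 2 ≤ d) {lam : Fin (d ^ 2 - 1) → Matrix (Fin d) (Fin d) ℂ}
    (hherm : ∀ i, (lam i).IsHermitian) (htr0 : ∀ i, (lam i).trace = 0)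
    (horth : ∀ i j, (lam i * lam j).trace = if i = j then (d : ℂ) else 0)
    {T : Type*} [Fintype T] [DecidableEq T] {ρ : Matrix T T ℂ} (hρ : ρ.IsHermitian)
    (htr1 : ρ.trace = 1) (hpure : ρ * ρ = ρ) (φ : T ≃ (Fin d × Fin d) × Fin d)
    {K : Matrix (Fin d) (Fin d) ℂ → Matrix (Fin d) (Fin d) ℂ → Matrix (Fin d) (Fin d) ℂ →
      Matrix T T ℂ}
    (hK : ∀ A B C, K A B C = (Matrix.kronecker (Matrix.kronecker A B) C).submatrix φ φ) :
    1 + ∑ i, ‖(ρ * K (lam i) 1 1).trace‖ ^ 2 + ∑ j, ‖(ρ * K 1 (lam j) 1).trace‖ ^ 2 +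
        ∑ i, ∑ j, ‖(ρ * K (lam i) (lam j) 1).trace‖ ^ 2 =
      d * (1 + ∑ l, ‖(ρ * K 1 1 (lam l)).trace‖ ^ 2) := by
  have hd0 : (d : ℂ) ≠ 0 := by norm_cast; lia
  have hcomp := isComplete_withOne hd htr0 horth
  have hherm' : ∀ k, (withOne lam k).IsHermitian := by
    rintro (_ | i)
    · exact Matrix.isHermitian_one
    · exact hherm i
  have kron_one_one : Matrix.kronecker (1 : Matrix (Fin d) (Fin d) ℂ)
      (1 : Matrix (Fin d) (Fin d) ℂ) = 1 := Matrix.one_kronecker_one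
  have hone : K 1 1 1 = 1 := by
    rw [hK, kron_one_one, Matrix.kronecker, Matrix.one_kronecker_one, Matrix.submatrix_one_equiv]
  have hnorm : ∀ i j k, (ρ * K (withOne lam i) (withOne lam j) (withOne lam k)).trace ^ 2 =
      ((‖(ρ * K (withOne lam i) (withOne lam j) (withOne lam k)).trace‖ ^ 2 : ℝ) : ℂ) := by
    intro i j k
    refine (norm_trace_mul_sq hρ ?_).symm
    rw [hK]
    refine Matrix.IsHermitian.submatrix ?_ _
    simp only [Matrix.IsHermitian, Matrix.kronecker, Matrix.conjTranspose_kronecker,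
      (hherm' _).eq]
  have h := (hcomp.kronecker hcomp).mul_sum_trace_kronecker_sq hcomp
    (mul_eq_mul_of_idempotent_of_trace_eq_one hpure htr1) φ
  simp only [← kron_one_one, ← hK, mul_assoc] at h
  have h := mul_left_cancel₀ hd0 h
  have hC := fun k => hnorm none none k
  have hAB := fun i j => hnorm i j none
  simp only [show withOne lam none = 1 from rfl] at hC hAB
  simp only [hC, hAB] at h
  norm_cast at h
  simp only [Fintype.sum_prod_type, Fintype.sum_option, Finset.sum_add_distrib] at h
  simp only [withOne, hone, Matrix.mul_one, htr1, norm_one, one_pow] at h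
  linarith

/-- The sum of the three isotropic strengths of a pure tripartite qudit state
(Eq. (9) of the paper). -/
theorem sum_isotropic_strengths_pure_tripartite (d : ℕ) (hd : 2 ≤ d)
    (lam : Fin (d ^ 2 - 1) → Matrix (Fin d) (Fin d) ℂ)
    (hherm : ∀ i, (lam i).IsHermitian)
    (htr0 : ∀ i, (lam i).trace = 0)
    (horth : ∀ i j, (lam i * lam j).trace = if i = j then (d : ℂ) else 0)
    (ρ : Matrix (Fin d × Fin d × Fin d) (Fin d × Fin d × Fin d) ℂ)
    (hpsd : ρ.PosSemidef) (htr1 : ρ.trace = 1) (hpure : ρ * ρ = ρ) :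
    sAB lam ρ + sBC lam ρ + sAC lam ρ =
      (3 * (d : ℝ) - 3 + ((d : ℝ) - 2) * (aSq lam ρ + bSq lam ρ + cSq lam ρ)) /
        ((d : ℝ) ^ 2 - 1) := by
  have hAB := bloch_norm_relation (K := fun A B C => kron3 A B C) hd hherm htr0 horth
    hpsd.isHermitian htr1 hpure (Equiv.prodAssoc _ _ _).symm fun A B C => by
      ext p q
      simp [kron3, Matrix.kronecker]
  have hBC := bloch_norm_relation (K := fun B C A => kron3 A B C) hd hherm htr0 horth
    hpsd.isHermitian htr1 hpure (Equiv.prodComm _ _) fun B C A => by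
      ext p q
      simp only [kron3, Matrix.kronecker, Matrix.of_apply, Matrix.submatrix_apply,
        Matrix.kroneckerMap_apply, Equiv.prodComm_apply, Prod.swap]
      ring
  have hAC := bloch_norm_relation (K := fun A C B => kron3 A B C) hd hherm htr0 horth
    hpsd.isHermitian htr1 hpure
    ⟨fun x => ((x.1, x.2.2), x.2.1), fun x => (x.1.1, x.2, x.1.2), fun _ => rfl, fun _ => rfl⟩
    fun A C B => by
      ext p q
      simp only [kron3, Matrix.kronecker, Matrix.of_apply, Matrix.submatrix_apply,
        Matrix.kroneckerMap_apply, Equiv.coe_fn_mk]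
      ring
  rw [sAB, sBC, sAC, ← add_div, ← add_div]
  congr 1
  unfold RABsq RBCsq RACsq aSq bSq cSq
  linarith

end SpinCorr3
end

section
/- Let ρ be a pure tripartite qudit state on ℂ^d ⊗ ℂ^d ⊗ ℂ^d. Then the three quantities obtained by pairing each single-party Bloch vector with the isotropic strength of the complementary pair coincide: (1/(d−1))‖a‖² − s_iso^{BC} = (1/(d−1))‖b‖² − s_iso^{AC} = (1/(d−1))‖c‖² − s_iso^{AB}. -/
open Matrix ComplexOrder

namespace SpinCorr3

variable {d : ℕ}

variable (lam : Fin (d ^ 2 - 1) → Matrix (Fin d) (Fin d) ℂ)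
variable (ρ : Matrix (Fin d × Fin d × Fin d) (Fin d × Fin d × Fin d) ℂ)

/-- Parseval's identity for a family of matrices whose members are orthogonal of squared length `c`
for the Hilbert-Schmidt inner product, and as numerous as the dimension of the matrix space. -/
lemma sum_norm_trace_mul_sq {n ι : Type*} [Fintype n] [DecidableEq n] [Fintype ι] [DecidableEq ι]
    (e : ι ≃ n × n) (B : ι → Matrix n n ℂ) {c : ℝ} (hc : c ≠ 0)
    (hB : ∀ i j, (B i * (B j)ᴴ).trace = if i = j then (c : ℂ) else 0) (M : Matrix n n ℂ) :
    ∑ i, ‖(M * B i).trace‖ ^ 2 = c * ∑ p, ∑ q, ‖M p q‖ ^ 2 := by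
  have hc' : (c : ℂ) ≠ 0 := by exact_mod_cast hc
  let U : Matrix ι (n × n) ℂ := of fun i p => B i p.1 p.2
  let x : n × n → ℂ := fun p => M p.2 p.1
  have hU : U * ((c : ℂ)⁻¹ • Uᴴ) = 1 := by
    ext i j
    have h := hB i j
    simp only [trace, diag, mul_apply, conjTranspose_apply] at h
    rw [Matrix.mul_smul, Matrix.smul_apply, mul_apply, Fintype.sum_prod_type]
    simp only [U, of_apply, conjTranspose_apply, h, one_apply]
    split_ifs <;> simp [hc']
  have hU' : Uᴴ * U = (c : ℂ) • 1 := by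
    have h := (mul_eq_one_comm_of_equiv e).1 hU
    rw [Matrix.smul_mul] at h
    rw [← h, smul_smul, mul_inv_cancel₀ hc', one_smul]
  have hx (i : ι) : (M * B i).trace = (U *ᵥ x) i := by
    simp only [trace, diag, mul_apply, mulVec, dotProduct, U, x, of_apply]
    rw [Finset.sum_comm, Fintype.sum_prod_type]
    simp only [mul_comm]
  have key : star (U *ᵥ x) ⬝ᵥ (U *ᵥ x) = c * (star x ⬝ᵥ x) := by
    rw [star_mulVec, ← dotProduct_mulVec, mulVec_mulVec, hU', smul_mulVec, one_mulVec,
      dotProduct_smul, smul_eq_mul]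
  simp only [dotProduct, Pi.star_apply, RCLike.star_def, Complex.conj_mul'] at key
  simp only [hx]
  rw [Finset.sum_comm (s := Finset.univ (α := n)), ← Fintype.sum_prod_type']
  exact_mod_cast key

/-- The `2 × 2` minors of an idempotent matrix of trace one vanish. -/
lemma mul_apply_swap_of_idempotent {n : Type*} [Fintype n] [DecidableEq n] {P : Matrix n n ℂ}
    (hP : P * P = P) (htr : P.trace = 1) (p q r s : n) : P p q * P r s = P p s * P r q := by
  have hid : IsIdempotentElem (toLin' P) := by
    rw [IsIdempotentElem, Module.End.mul_eq_comp, ← toLin'_mul, hP]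
  have hrank := (LinearMap.IsIdempotentElem.isProj_range _ hid).trace
  rw [trace_toLin'_eq, htr] at hrank
  obtain ⟨v, -, hv⟩ := finrank_eq_one_iff'.1 (Nat.cast_eq_one.1 hrank.symm)
  have hcol (q : n) : ∃ c : ℂ, ∀ p, P p q = c * v.1 p := by
    obtain ⟨c, hc⟩ := hv ⟨toLin' P (Pi.single q 1), LinearMap.mem_range_self _ _⟩
    refine ⟨c, fun p => ?_⟩
    have := congrFun (congrArg Subtype.val hc) p
    simpa using this.symm
  choose c hc using hcol
  simp only [hc]
  ring

/-- The reduced matrix of party A. -/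
noncomputable def reducedA : Matrix (Fin d) (Fin d) ℂ :=
  of fun i j => ∑ k, ρ (i, k) (j, k)

/-- The reduced matrix of parties B and C. -/
noncomputable def reducedBC : Matrix (Fin d × Fin d) (Fin d × Fin d) ℂ :=
  of fun k l => ∑ i, ρ (i, k) (i, l)

open scoped Kronecker in
lemma trace_mul_kron3 (A B C : Matrix (Fin d) (Fin d) ℂ) :
    (ρ * kron3 A B C).trace =
      ∑ i, ∑ k, ∑ j, ∑ l, ρ (i, k) (j, l) * (A j i * (B ⊗ₖ C) l k) := by
  simp only [trace, diag, mul_apply, kron3, of_apply, kroneckerMap_apply, Fintype.sum_prod_type,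
    mul_assoc]

lemma trace_mul_kron3_left (A : Matrix (Fin d) (Fin d) ℂ) :
    (ρ * kron3 A 1 1).trace = (reducedA ρ * A).trace := by
  rw [trace_mul_kron3, one_kronecker_one]
  simp only [trace, diag, mul_apply, reducedA, of_apply, one_apply, Finset.sum_mul, mul_ite,
    mul_one, mul_zero, Finset.sum_ite_eq', Finset.mem_univ, if_true]
  exact Finset.sum_congr rfl fun i _ => Finset.sum_comm

open scoped Kronecker in
lemma trace_mul_kron3_right (B C : Matrix (Fin d) (Fin d) ℂ) :
    (ρ * kron3 1 B C).trace = (reducedBC ρ * (B ⊗ₖ C)).trace := by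
  rw [trace_mul_kron3]
  simp only [trace, diag, mul_apply, reducedBC, of_apply, one_apply, Finset.sum_mul, ite_mul,
    one_mul, zero_mul]
  rw [Finset.sum_comm]
  refine Finset.sum_congr rfl fun k _ => ?_
  rw [Finset.sum_comm (s := Finset.univ (α := Fin d × Fin d))]
  refine Finset.sum_congr rfl fun i _ => ?_
  rw [Finset.sum_comm]
  simp

/-- Complementary reductions of a pure state have the same purity. -/
lemma sum_norm_reducedA_sq (hρ : ρ.IsHermitian)
    (hswap : ∀ p q r s, ρ p q * ρ r s = ρ p s * ρ r q) :
    ∑ i, ∑ j, ‖reducedA ρ i j‖ ^ 2 = ∑ k, ∑ l, ‖reducedBC ρ k l‖ ^ 2 := by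
  have hA (i j) : ((‖reducedA ρ i j‖ ^ 2 : ℝ) : ℂ) =
      ∑ k, ∑ l, ρ (i, k) (i, l) * ρ (j, l) (j, k) := by
    rw [Complex.ofReal_pow, ← Complex.mul_conj']
    simp only [reducedA, of_apply, map_sum, Finset.sum_mul_sum, starRingEnd_apply, hρ.apply]
    exact Finset.sum_congr rfl fun k _ => Finset.sum_congr rfl fun l _ => hswap _ _ _ _
  have hBC (k l) :
      ((‖reducedBC ρ k l‖ ^ 2 : ℝ) : ℂ) = ∑ i, ∑ j, ρ (i, k) (i, l) * ρ (j, l) (j, k) := by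
    rw [Complex.ofReal_pow, ← Complex.mul_conj']
    simp only [reducedBC, of_apply, map_sum, Finset.sum_mul_sum, starRingEnd_apply, hρ.apply]
  apply Complex.ofReal_injective
  simp only [Complex.ofReal_sum, hA, hBC]
  refine (Finset.sum_congr rfl fun i _ => Finset.sum_comm).trans
    (Finset.sum_comm.trans (Finset.sum_congr rfl fun k _ => ?_))
  exact (Finset.sum_congr rfl fun i _ => Finset.sum_comm).trans Finset.sum_comm

/-- The linear relation between the correlations of a pure state that comes from the equality of the
purities of party A and of the pair BC. -/
lemma aSq_eq (hd : 2 ≤ d) (hherm : ∀ i, (lam i).IsHermitian) (htr0 : ∀ i, (lam i).trace = 0)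
    (horth : ∀ i j, (lam i * lam j).trace = if i = j then (d : ℂ) else 0)
    (hρ : ρ.IsHermitian) (htr1 : ρ.trace = 1)
    (hswap : ∀ p q r s, ρ p q * ρ r s = ρ p s * ρ r q) :
    d * (1 + aSq lam ρ) = 1 + bSq lam ρ + cSq lam ρ + RBCsq lam ρ := by
  let B : Option (Fin (d ^ 2 - 1)) → Matrix (Fin d) (Fin d) ℂ := fun o => o.elim 1 lam
  have hd0 : (d : ℝ) ≠ 0 := by positivity
  have hB (i j) : (B i * (B j)ᴴ).trace = if i = j then ((d : ℝ) : ℂ) else 0 := by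
    cases i <;> cases j <;> simp [B, htr0, horth, (hherm _).eq]
  have hcard : Fintype.card (Option (Fin (d ^ 2 - 1))) = Fintype.card (Fin d × Fin d) := by
    have : 0 < d ^ 2 := by positivity
    simp only [Fintype.card_option, Fintype.card_fin, Fintype.card_prod]
    rw [← sq]
    omega
  let e := Fintype.equivOfCardEq hcard
  have hone : kron3 (1 : Matrix (Fin d) (Fin d) ℂ) 1 1 = 1 := by
    ext p q
    simp only [kron3, of_apply, one_apply, Prod.ext_iff]
    grind
  have h1 := sum_norm_trace_mul_sq e B hd0 hB (reducedA ρ)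
  have h2 := sum_norm_trace_mul_sq (e.prodCongr e |>.trans (Equiv.prodProdProdComm _ _ _ _))
    (fun o => kroneckerMap (· * ·) (B o.1) (B o.2)) (mul_ne_zero hd0 hd0) (fun i j => by
      rw [conjTranspose_kronecker, ← mul_kronecker_mul, trace_kronecker, hB, hB]
      rcases i with ⟨i, i'⟩
      rcases j with ⟨j, j'⟩
      by_cases h : i = j <;> by_cases h' : i' = j' <;> simp [h, h']) (reducedBC ρ)
  simp only [← trace_mul_kron3_left, ← trace_mul_kron3_right, Fintype.sum_prod_type,
    Fintype.sum_option, B, Option.elim, hone, mul_one, htr1] at h1 h2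
  rw [sum_norm_reducedA_sq ρ hρ hswap] at h1
  simp only [Finset.sum_add_distrib, norm_one, one_pow] at h1 h2
  simp only [aSq, bSq, cSq, RBCsq]
  simp only [Fintype.sum_prod_type] at h1
  linear_combination (d : ℝ) * h1 - h2

/-- The cyclic permutation of the three parties. -/
def rot (d : ℕ) : Fin d × Fin d × Fin d ≃ Fin d × Fin d × Fin d where
  toFun p := (p.2.2, p.1, p.2.1)
  invFun p := (p.2.1, p.2.2, p.1)
  left_inv _ := rfl
  right_inv _ := rfl

lemma trace_submatrix_rot (M : Matrix (Fin d × Fin d × Fin d) (Fin d × Fin d × Fin d) ℂ) :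
    (M.submatrix (rot d) (rot d)).trace = M.trace :=
  (rot d).sum_comp fun p => M p p

lemma trace_submatrix_rot_mul_kron3 (A B C : Matrix (Fin d) (Fin d) ℂ) :
    (ρ.submatrix (rot d) (rot d) * kron3 A B C).trace = (ρ * kron3 C A B).trace := by
  have h : kron3 A B C = (kron3 C A B).submatrix (rot d) (rot d) := by
    ext p q
    simp only [kron3, rot, submatrix_apply, of_apply, Equiv.coe_fn_mk]
    ring
  rw [h, submatrix_mul_equiv, trace_submatrix_rot]

/-- For a pure tripartite qudit state, the quantities pairing each single-party Bloch
vector with the isotropic strength of the complementary pair coincide (Eq. (13)). -/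
theorem bloch_complementary_pair_identity (d : ℕ) (hd : 2 ≤ d)
    (lam : Fin (d ^ 2 - 1) → Matrix (Fin d) (Fin d) ℂ)
    (hherm : ∀ i, (lam i).IsHermitian)
    (htr0 : ∀ i, (lam i).trace = 0)
    (horth : ∀ i j, (lam i * lam j).trace = if i = j then (d : ℂ) else 0)
    (ρ : Matrix (Fin d × Fin d × Fin d) (Fin d × Fin d × Fin d) ℂ)
    (hpsd : ρ.PosSemidef) (htr1 : ρ.trace = 1) (hpure : ρ * ρ = ρ) :
    (1 / ((d : ℝ) - 1)) * aSq lam ρ - sBC lam ρ =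
        (1 / ((d : ℝ) - 1)) * bSq lam ρ - sAC lam ρ ∧
    (1 / ((d : ℝ) - 1)) * bSq lam ρ - sAC lam ρ =
        (1 / ((d : ℝ) - 1)) * cSq lam ρ - sAB lam ρ := by
  have hswap := mul_apply_swap_of_idempotent hpure htr1
  have hH := hpsd.isHermitian
  have key (ρ : Matrix (Fin d × Fin d × Fin d) (Fin d × Fin d × Fin d) ℂ) :=
    aSq_eq lam ρ hd hherm htr0 horth
  have hA := key ρ hH htr1 hswap
  have hC := key (ρ.submatrix (rot d) (rot d)) (hH.submatrix _)
    ((trace_submatrix_rot _).trans htr1) fun _ _ _ _ => hswap _ _ _ _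
  have hB := key ((ρ.submatrix (rot d) (rot d)).submatrix (rot d) (rot d))
    ((hH.submatrix _).submatrix _)
    (((trace_submatrix_rot _).trans (trace_submatrix_rot _)).trans htr1)
    fun _ _ _ _ => hswap _ _ _ _
  simp only [aSq, bSq, cSq, RBCsq, trace_submatrix_rot_mul_kron3] at hA hB hC
  have hd' : (2 : ℝ) ≤ d := by exact_mod_cast hd
  have h1 : (d : ℝ) - 1 ≠ 0 := by linarith
  have h2 : (d : ℝ) ^ 2 - 1 ≠ 0 := by nlinarith
  have hcomm := Finset.sum_comm (s := Finset.univ) (t := Finset.univ)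
    (f := fun l i => ‖(ρ * kron3 (lam i) 1 (lam l)).trace‖ ^ 2)
  have hdiv (x : ℝ) : 1 / ((d : ℝ) - 1) * x = (d + 1) * x / ((d : ℝ) ^ 2 - 1) := by
    field_simp
    ring
  simp only [sAB, sBC, sAC, aSq, bSq, cSq, RABsq, RBCsq, RACsq, hdiv, ← sub_div]
  constructor <;> congr 1 <;> linarith

end SpinCorr3
end
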